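/- (Explicit pointwise bound, inequality (9)) Let σ_f, σ_l > 0 and let k be the Gaussian kernel on ℝⁿ. Given points x̂₁, …, x̂_N ∈ ℝⁿ and x̂₊₁, …, x̂₊_N ∈ ℝⁿ, λ > 0, let K, K³, W, β, C be as in the context. Then for all x, c ∈ ℝⁿ, √((β(x) − β(c))ᵀ K³ (β(x) − β(c))) ≤ C · (σ_f / σ_l) · ‖x − c‖. -/

import Mathlib

open Matrix
open scoped BigOperators

/-- The Gaussian kernel on `ℝⁿ` with parameters `σf, σl`. -/
noncomputable def gaussianKernel (σf σl : ℝ) {n : ℕ}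
    (x y : EuclideanSpace ℝ (Fin n)) : ℝ :=
  σf ^ 2 * Real.exp (-‖x - y‖ ^ 2 / (2 * σl ^ 2))

open MeasureTheory ProbabilityTheory

section GaussianKernel

variable {n : ℕ} (σf σl : ℝ)

lemma gaussianKernel_comm (x y : EuclideanSpace ℝ (Fin n)) :
    gaussianKernel σf σl x y = gaussianKernel σf σl y x := by
  rw [gaussianKernel, gaussianKernel, norm_sub_rev]

lemma gaussianKernel_self (x : EuclideanSpace ℝ (Fin n)) :
    gaussianKernel σf σl x x = σf ^ 2 := by
  simp [gaussianKernel]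

lemma integrable_cos_inner_stdGaussian (t : EuclideanSpace ℝ (Fin n)) :
    Integrable (fun ξ => Real.cos (inner ℝ ξ t)) (stdGaussian (EuclideanSpace ℝ (Fin n))) :=
  Integrable.of_bound (by fun_prop) 1 (ae_of_all _ fun ξ => Real.abs_cos_le_one _)

lemma integral_cos_inner_stdGaussian (t : EuclideanSpace ℝ (Fin n)) :
    ∫ ξ, Real.cos (inner ℝ ξ t) ∂stdGaussian (EuclideanSpace ℝ (Fin n)) =
      Real.exp (-‖t‖ ^ 2 / 2) := by
  have hcos : Integrable (fun ξ => Complex.exp ((inner ℝ ξ t : ℝ) * Complex.I))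
      (stdGaussian (EuclideanSpace ℝ (Fin n))) :=
    Integrable.of_bound (by fun_prop) 1
      (ae_of_all _ fun ξ => (Complex.norm_exp_ofReal_mul_I _).le)
  have h := congrArg Complex.re (charFun_stdGaussian t)
  rw [charFun_apply, ← RCLike.re_eq_complex_re, ← integral_re hcos] at h
  simp only [RCLike.re_eq_complex_re, Complex.exp_ofReal_mul_I_re] at h
  rw [h]
  rw [← Complex.exp_ofReal_re]
  push_cast
  rfl

/-- Bochner's representation of the Gaussian kernel as a Gaussian average of characters. -/
lemma gaussianKernel_eq_integral_cos (hσl : σl ≠ 0) (x y : EuclideanSpace ℝ (Fin n)) :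
    gaussianKernel σf σl x y = σf ^ 2 *
      ∫ ξ, Real.cos (inner ℝ ξ (σl⁻¹ • (x - y))) ∂stdGaussian (EuclideanSpace ℝ (Fin n)) := by
  rw [integral_cos_inner_stdGaussian, gaussianKernel, norm_smul, mul_pow, Real.norm_eq_abs, sq_abs]
  congr 2
  field_simp

lemma sum_sum_mul_cos_sub_nonneg {ι : Type*} [Fintype ι] (a θ : ι → ℝ) :
    0 ≤ ∑ i, ∑ j, a i * a j * Real.cos (θ i - θ j) := by
  have h : ∑ i, ∑ j, a i * a j * Real.cos (θ i - θ j) =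
      (∑ i, a i * Real.cos (θ i)) ^ 2 + (∑ i, a i * Real.sin (θ i)) ^ 2 := by
    simp_rw [sq, Finset.sum_mul_sum, ← Finset.sum_add_distrib, Real.cos_sub]
    refine Finset.sum_congr rfl fun i _ => Finset.sum_congr rfl fun j _ => ?_
    ring
  rw [h]
  positivity

/-- The Gaussian kernel is positive semidefinite. -/
lemma sum_sum_mul_gaussianKernel_nonneg (hσl : σl ≠ 0) {ι : Type*} [Fintype ι]
    (x : ι → EuclideanSpace ℝ (Fin n)) (a : ι → ℝ) :
    0 ≤ ∑ i, ∑ j, a i * a j * gaussianKernel σf σl (x i) (x j) := by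
  have h : ∑ i, ∑ j, a i * a j * gaussianKernel σf σl (x i) (x j) = σf ^ 2 *
      ∫ ξ, ∑ i, ∑ j, a i * a j * Real.cos (inner ℝ ξ (σl⁻¹ • (x i - x j)))
        ∂stdGaussian (EuclideanSpace ℝ (Fin n)) := by
    have hcos (i j) := (integrable_cos_inner_stdGaussian (σl⁻¹ • (x i - x j))).const_mul (a i * a j)
    rw [integral_finsetSum _ fun i _ => integrable_finsetSum _ fun j _ => hcos i j]
    simp_rw [integral_finsetSum _ fun j _ => hcos _ j, integral_const_mul, Finset.mul_sum,
      gaussianKernel_eq_integral_cos σf σl hσl]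
    refine Finset.sum_congr rfl fun i _ => Finset.sum_congr rfl fun j _ => ?_
    ring
  rw [h]
  refine mul_nonneg (sq_nonneg _) (integral_nonneg fun ξ => ?_)
  simp only [smul_sub, inner_sub_right]
  exact sum_sum_mul_cos_sub_nonneg a fun i => inner ℝ ξ (σl⁻¹ • x i)

lemma dotProduct_mulVec_eq_sum_sum {ι : Type*} [Fintype ι] (M : Matrix ι ι ℝ) (a : ι → ℝ) :
    a ⬝ᵥ (M *ᵥ a) = ∑ i, ∑ j, a i * a j * M i j := by
  simp only [dotProduct, mulVec, Finset.mul_sum]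
  refine Finset.sum_congr rfl fun i _ => Finset.sum_congr rfl fun j _ => ?_
  ring

lemma posSemidef_gaussianKernel (hσl : σl ≠ 0) {ι : Type*} [Fintype ι]
    (x : ι → EuclideanSpace ℝ (Fin n)) :
    (Matrix.of fun i j => gaussianKernel σf σl (x i) (x j)).PosSemidef := by
  refine .of_dotProduct_mulVec_nonneg ?_ fun a => ?_
  · ext i j
    simp [gaussianKernel_comm σf σl (x i) (x j)]
  · rw [star_trivial, dotProduct_mulVec_eq_sum_sum]
    exact sum_sum_mul_gaussianKernel_nonneg σf σl hσl x a

/-- The squared distance of the feature vectors of `x` and `c` is at most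
`(σf / σl * ‖x - c‖) ^ 2`. -/
lemma two_mul_sub_gaussianKernel_le (x c : EuclideanSpace ℝ (Fin n)) :
    2 * (σf ^ 2 - gaussianKernel σf σl x c) ≤ (σf / σl * ‖x - c‖) ^ 2 := by
  have h := Real.add_one_le_exp (-‖x - c‖ ^ 2 / (2 * σl ^ 2))
  have h' := mul_le_mul_of_nonneg_left h (sq_nonneg σf)
  have e : (σf / σl * ‖x - c‖) ^ 2 = -2 * (σf ^ 2 * (-‖x - c‖ ^ 2 / (2 * σl ^ 2))) := by
    ring
  rw [e, gaussianKernel]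
  linarith

/-- The Cauchy–Schwarz inequality in the reproducing kernel Hilbert space of the Gaussian kernel. -/
lemma sq_sum_mul_gaussianKernel_sub_le (hσl : σl ≠ 0) {ι : Type*} [Fintype ι]
    (y : ι → EuclideanSpace ℝ (Fin n)) (a : ι → ℝ) (x c : EuclideanSpace ℝ (Fin n)) :
    (∑ i, a i * (gaussianKernel σf σl x (y i) - gaussianKernel σf σl c (y i))) ^ 2 ≤
      (σf / σl * ‖x - c‖) ^ 2 *
        ∑ i, ∑ j, a i * a j * gaussianKernel σf σl (y i) (y j) := by
  have hK := sum_sum_mul_gaussianKernel_nonneg σf σl hσl y a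
  set Q := ∑ i, ∑ j, a i * a j * gaussianKernel σf σl (y i) (y j) with hQ
  set v := ∑ i, a i * (gaussianKernel σf σl x (y i) - gaussianKernel σf σl c (y i)) with hv
  have key (s : ℝ) :
      0 ≤ 2 * (σf ^ 2 - gaussianKernel σf σl x c) * (s * s) + 2 * v * s + Q := by
    have h := sum_sum_mul_gaussianKernel_nonneg σf σl hσl
      (Sum.elim y ![x, c]) (Sum.elim a ![s, -s])
    simp only [Fintype.sum_sum_type, Sum.elim_inl, Sum.elim_inr, Fin.sum_univ_two,
      Matrix.cons_val_zero, Matrix.cons_val_one, Finset.sum_add_distrib, gaussianKernel_self,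
      gaussianKernel_comm σf σl c x, gaussianKernel_comm σf σl (y _) x,
      gaussianKernel_comm σf σl (y _) c, ← hQ] at h
    have hvs : v * s = ∑ i, s * a i * gaussianKernel σf σl x (y i) +
        ∑ i, -s * a i * gaussianKernel σf σl c (y i) := by
      rw [hv, Finset.sum_mul, ← Finset.sum_add_distrib]
      exact Finset.sum_congr rfl fun i _ => by ring
    simp only [mul_comm (a _) s, mul_comm (a _) (-s)] at h
    linarith
  have hd := discrim_le_zero key
  rw [discrim] at hd
  nlinarith [mul_le_mul_of_nonneg_right (two_mul_sub_gaussianKernel_le σf σl x c) hK]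

end GaussianKernel

lemma Matrix.PosSemidef.sum_sum_mul_nonneg {ι : Type*} [Fintype ι] {A B : Matrix ι ι ℝ}
    (hA : A.PosSemidef) (hB : B.PosSemidef) : 0 ≤ ∑ i, ∑ j, A i j * B i j := by
  simpa [dotProduct_mulVec_eq_sum_sum] using (hA.hadamard hB).dotProduct_mulVec_nonneg 1

theorem cme_pointwise_explicit_bound {n N : ℕ} (σf σl : ℝ)
    (hσf : 0 < σf) (hσl : 0 < σl)
    (k : EuclideanSpace ℝ (Fin n) → EuclideanSpace ℝ (Fin n) → ℝ)
    (hk : k = gaussianKernel σf σl)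
    (xh xp : Fin N → EuclideanSpace ℝ (Fin n))
    (lam : ℝ) (hlam : 0 < lam)
    (K : Matrix (Fin N) (Fin N) ℝ) (hKdef : ∀ i j, K i j = k (xh i) (xh j))
    (K3 : Matrix (Fin N) (Fin N) ℝ) (hK3def : ∀ i j, K3 i j = k (xp i) (xp j))
    (W : Matrix (Fin N) (Fin N) ℝ)
    (hW : W = (K + ((N : ℝ) * lam) • (1 : Matrix (Fin N) (Fin N) ℝ))⁻¹)
    (β : EuclideanSpace ℝ (Fin n) → (Fin N → ℝ))
    (hβ : ∀ x, β x = W *ᵥ (fun i => k x (xh i)))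
    (C : ℝ) (hC : C = Real.sqrt (∑ i, ∑ j, (W * K * Wᵀ) i j * K3 i j)) :
    ∀ x c : EuclideanSpace ℝ (Fin n),
      Real.sqrt ((β x - β c) ⬝ᵥ (K3 *ᵥ (β x - β c))) ≤
        C * (σf / σl) * ‖x - c‖ := by
  intro x c
  subst hk
  have hK3 : K3.PosSemidef := by
    convert posSemidef_gaussianKernel σf σl hσl.ne' xp
    ext i j
    exact hK3def i j
  have hKpsd : K.PosSemidef := by
    convert posSemidef_gaussianKernel σf σl hσl.ne' xh
    ext i j
    exact hKdef i j
  set D := (σf / σl * ‖x - c‖) ^ 2 with hD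
  set v : Fin N → ℝ := fun i => gaussianKernel σf σl x (xh i) - gaussianKernel σf σl c (xh i)
    with hv
  have hβv : β x - β c = W *ᵥ v := by
    rw [hβ, hβ, ← mulVec_sub]
    rfl
  have hM : (D • K - vecMulVec v v).PosSemidef := by
    refine .of_dotProduct_mulVec_nonneg ?_ fun a => ?_
    · refine IsHermitian.sub ?_ ?_
      · ext i j
        simp [hKdef, gaussianKernel_comm σf σl (xh i)]
      · ext i j
        simp [vecMulVec_apply, mul_comm]
    · have h := sq_sum_mul_gaussianKernel_sub_le σf σl hσl.ne' xh a x c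
      rw [star_trivial, sub_mulVec, dotProduct_sub, smul_mulVec, dotProduct_smul,
        vecMulVec_mulVec, dotProduct_mulVec_eq_sum_sum, sub_nonneg]
      simp only [hKdef, smul_eq_mul]
      refine le_of_eq_of_le ?_ h
      rw [dotProduct_smul, dotProduct_comm v a, op_smul_eq_mul, sq]
      rfl
  have hWM := (hM.mul_mul_conjTranspose_same W).sum_sum_mul_nonneg hK3
  have hWvv : W * vecMulVec v v * Wᵀ = vecMulVec (W *ᵥ v) (W *ᵥ v) := by
    rw [mul_vecMulVec, vecMulVec_mul, vecMul_transpose]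
  rw [conjTranspose_eq_transpose_of_trivial, Matrix.mul_sub, Matrix.sub_mul, hWvv, Matrix.mul_smul,
    Matrix.smul_mul] at hWM
  simp only [Matrix.sub_apply, Matrix.smul_apply, smul_eq_mul, vecMulVec_apply, sub_mul, mul_assoc D,
    Finset.sum_sub_distrib, ← Finset.mul_sum] at hWM
  rw [hβv, dotProduct_mulVec_eq_sum_sum, hC, mul_assoc,
    ← Real.sqrt_sq (by positivity : 0 ≤ σf / σl * ‖x - c‖), ← hD, mul_comm,
    ← Real.sqrt_mul (sq_nonneg _)]
  exact Real.sqrt_le_sqrt (by linarith)
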